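/- Let X be a non-negative absolutely continuous random variable with probability density function f and cumulative distribution function F, such that ∫₀^∞ f(x)² dx < ∞, the weighted negative cumulative extropy η̄¹J(X) is finite, and E[|log(X(1 − F(X)²))|] < ∞. Then η̄¹J(X) ≥ C* exp(2J(X)), where J(X) = −(1/2)∫₀^∞ f(x)² dx is the extropy of X and C* = (1/2) exp(E[log(X(1 − F(X)²))]). -/

import Mathlib

open MeasureTheory Real

/-- A law on the real line without atoms gives no mass to the set of points above which it has
no mass. -/
lemma measure_setOf_measure_Ioi_eq_zero (P : Measure ℝ) [NullSingletonClass P] :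
    P {x | P (Set.Ioi x) = 0} = 0 := by
  set S := {x | P (Set.Ioi x) = 0} with hS
  obtain ⟨T, hTS, hTc, hTU⟩ := TopologicalSpace.isOpen_biUnion_countable S (fun x => Set.Ioi x)
    (fun _ _ => isOpen_Ioi)
  have hU : P (⋃ x ∈ S, Set.Ioi x) = 0 := by
    rw [← hTU]
    exact (measure_biUnion_null_iff hTc).2 fun x hx => hTS hx
  have hsub : (S \ ⋃ x ∈ S, Set.Ioi x).Subsingleton := by
    rintro a ⟨haS, ha⟩ b ⟨hbS, hb⟩
    simp only [Set.mem_iUnion, Set.mem_Ioi, not_exists, not_lt] at ha hb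
    exact le_antisymm (ha b hbS) (hb a haS)
  refine measure_mono_null (t := (S \ ⋃ x ∈ S, Set.Ioi x) ∪ ⋃ x ∈ S, Set.Ioi x) ?_
    (measure_union_null (hsub.measure_zero P) hU)
  rw [Set.sdiff_union_self]
  exact Set.subset_union_left

/-- The tangent line bound for `exp`, applied to `log g - f`. -/
lemma exp_mul_tangent_le {f g : ℝ} (hf : 0 ≤ f) (hg : 0 < g) (c : ℝ) :
    Real.exp c * (f * (1 - c) + f * Real.log g - f ^ 2) ≤ g := by
  have h1 : 1 + Real.log g - f - c ≤ Real.exp (Real.log g - f - c) := by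
    linarith [Real.add_one_le_exp (Real.log g - f - c)]
  have h2 : f ≤ Real.exp f := by linarith [Real.add_one_le_exp f]
  calc Real.exp c * (f * (1 - c) + f * Real.log g - f ^ 2)
      = Real.exp c * (f * (1 + Real.log g - f - c)) := by ring
    _ ≤ Real.exp c * (f * Real.exp (Real.log g - f - c)) := by gcongr
    _ ≤ Real.exp c * (Real.exp f * Real.exp (Real.log g - f - c)) := by gcongr
    _ = Real.exp (Real.log g) := by
        rw [← Real.exp_add, ← Real.exp_add]; congr 1; ring
    _ = g := Real.exp_log hg

/-- A Gibbs-type inequality: if `f` is a probability density, then `∫ g` is at least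
`exp (∫ f log g - ∫ f²)`. -/
lemma exp_integral_mul_log_sub_le {α : Type*} [MeasurableSpace α] {ν : Measure α} {f g : α → ℝ}
    (hf0 : ∀ x, 0 ≤ f x) (hf : Integrable f ν) (hf1 : ∫ x, f x ∂ν = 1)
    (hf2 : Integrable (fun x => f x ^ 2) ν) (hg : Integrable g ν) (hg0 : 0 ≤ᵐ[ν] g)
    (hpos : ∀ᵐ x ∂ν, f x ≠ 0 → 0 < g x)
    (hlog : Integrable (fun x => f x * Real.log (g x)) ν) :
    Real.exp (∫ x, f x * Real.log (g x) ∂ν - ∫ x, f x ^ 2 ∂ν) ≤ ∫ x, g x ∂ν := by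
  set c := ∫ x, f x * Real.log (g x) ∂ν - ∫ x, f x ^ 2 ∂ν with hc
  have hfc : Integrable (fun x => f x * (1 - c)) ν := hf.mul_const _
  have hsum : Integrable (fun x => f x * (1 - c) + f x * Real.log (g x)) ν := hfc.add hlog
  calc Real.exp c
      = ∫ x, Real.exp c * (f x * (1 - c) + f x * Real.log (g x) - f x ^ 2) ∂ν := by
        rw [integral_const_mul, integral_sub hsum hf2, integral_add hfc hlog,
          integral_mul_const, hf1, one_mul]
        have : 1 - c + ∫ x, f x * Real.log (g x) ∂ν - ∫ x, f x ^ 2 ∂ν = 1 := by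
          rw [hc]; ring
        rw [this, mul_one]
    _ ≤ ∫ x, g x ∂ν := by
        refine integral_mono_ae ((hsum.sub hf2).const_mul _) hg ?_
        filter_upwards [hg0, hpos] with x hx0 hx
        by_cases hfx : f x = 0
        · simpa [hfx] using hx0
        · exact exp_mul_tangent_le (hf0 x) (hx hfx) c

/-- For a non-negative absolutely continuous random variable `X` with density
`f` and cdf `F` such that `∫₀^∞ f² < ∞`, `η̄¹J(X)` is finite, and
`E|log(X(1-F(X)²))| < ∞`, one has `η̄¹J(X) ≥ C* exp(2 J(X))`, with
`J(X) = -(1/2)∫₀^∞ f²` and `C* = (1/2) exp(E[log(X(1-F(X)²))])`. -/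
theorem wncj_lower_bound_extropy
    {Ω : Type*} [MeasurableSpace Ω] (μ : Measure Ω) [IsProbabilityMeasure μ]
    (X : Ω → ℝ) (hX : Measurable X) (h0 : ∀ ω, 0 ≤ X ω)
    (f : ℝ → ℝ) (hf : Measurable f) (hf0 : ∀ x, 0 ≤ f x)
    (hdens : Measure.map X μ = volume.withDensity (fun x => ENNReal.ofReal (f x)))
    (F : ℝ → ℝ) (hF : ∀ x, F x = (μ {ω | X ω ≤ x}).toReal)
    (hintf : IntegrableOn (fun x => f x ^ 2) (Set.Ioi 0))
    (hint1 : IntegrableOn (fun x => x * (1 - F x ^ 2)) (Set.Ioi 0))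
    (hlog : Integrable (fun ω => Real.log (X ω * (1 - F (X ω) ^ 2))) μ) :
    (1 / 2) * ∫ x in Set.Ioi (0 : ℝ), x * (1 - F x ^ 2)
      ≥ (1 / 2) * Real.exp (∫ ω, Real.log (X ω * (1 - F (X ω) ^ 2)) ∂μ) *
          Real.exp (2 * (-(1 / 2) * ∫ x in Set.Ioi (0 : ℝ), f x ^ 2)) := by
  set P := Measure.map X μ with hP
  have : IsProbabilityMeasure P := Measure.isProbabilityMeasure_map hX.aemeasurable
  have hac : P ≪ volume := hdens ▸ withDensity_absolutelyContinuous _ _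
  have : NullSingletonClass P := ⟨fun x => hac (measure_singleton x)⟩
  have hfm : Measurable fun x => ENNReal.ofReal (f x) := hf.ennreal_ofReal
  have hFP : ∀ x, F x = P.real (Set.Iic x) := fun x => by
    rw [hF, Measure.real, hP, Measure.map_apply hX measurableSet_Iic]; rfl
  have hFmono : Monotone F := fun a b hab => by
    rw [hFP, hFP]; exact measureReal_mono (Set.Iic_subset_Iic.2 hab)
  have hFm : Measurable F := hFmono.measurable
  have hF0 : ∀ x, 0 ≤ F x := fun x => by rw [hFP]; exact measureReal_nonneg
  have hF1 : ∀ x, F x ≤ 1 := fun x => by rw [hFP]; exact measureReal_le_one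
  have hFlt : ∀ᵐ x ∂P, F x < 1 := by
    rw [ae_iff]
    refine measure_mono_null (fun x hx => ?_) (measure_setOf_measure_Ioi_eq_zero P)
    have hx1 : P.real (Set.Iic x) = 1 := by
      rw [← hFP]; exact le_antisymm (hF1 x) (not_lt.1 hx)
    have hcompl := probReal_compl_eq_one_sub (μ := P) (measurableSet_Iic (a := x))
    rw [hx1, sub_self, Set.compl_Iic] at hcompl
    exact (measureReal_eq_zero_iff).1 hcompl
  set ν := (volume : Measure ℝ).restrict (Set.Ioi 0) with hν
  have hPpos : ∀ᵐ x ∂P, x ∈ Set.Ioi (0 : ℝ) := by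
    have hnonneg : ∀ᵐ x ∂P, 0 ≤ x := by
      rw [hP, ae_map_iff hX.aemeasurable measurableSet_Ici]
      exact Filter.Eventually.of_forall h0
    have hne : ∀ᵐ x ∂P, x ≠ 0 := by
      simp [ae_iff]
    filter_upwards [hnonneg, hne] with x h1 h2
    exact lt_of_le_of_ne h1 h2.symm
  have hPν : P = ν.withDensity fun x => ENNReal.ofReal (f x) := by
    rw [← Measure.restrict_eq_self_of_ae_mem hPpos, hdens,
      restrict_withDensity measurableSet_Ioi]
  have hPint : ∀ h : ℝ → ℝ, ∫ x, h x ∂P = ∫ x, f x * h x ∂ν := fun h => by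
    rw [hPν, integral_withDensity_eq_integral_toReal_smul hfm
      (Filter.Eventually.of_forall fun _ => ENNReal.ofReal_lt_top)]
    simp [ENNReal.toReal_ofReal (hf0 _)]
  have hPintegrable : ∀ h : ℝ → ℝ, Integrable h P → Integrable (fun x => f x * h x) ν := by
    intro h hh
    rw [hPν, integrable_withDensity_iff_integrable_smul' hfm
      (Filter.Eventually.of_forall fun _ => ENNReal.ofReal_lt_top)] at hh
    simpa [ENNReal.toReal_ofReal (hf0 _)] using hh
  have hgm : Measurable fun x => Real.log (x * (1 - F x ^ 2)) := by fun_prop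
  have hlogP : Integrable (fun x => Real.log (x * (1 - F x ^ 2))) P :=
    (integrable_map_measure hgm.aestronglyMeasurable hX.aemeasurable).2 hlog
  have hElog : ∫ ω, Real.log (X ω * (1 - F (X ω) ^ 2)) ∂μ
      = ∫ x, f x * Real.log (x * (1 - F x ^ 2)) ∂ν := by
    rw [← hPint, hP, integral_map hX.aemeasurable hgm.aestronglyMeasurable]
  have hposν : ∀ᵐ x ∂ν, f x ≠ 0 → 0 < x * (1 - F x ^ 2) := by
    rw [hPν, ae_withDensity_iff hfm] at hFlt
    filter_upwards [hFlt, ae_restrict_mem measurableSet_Ioi] with x hx hx0 hfx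
    have hlt := hx (by simpa using lt_of_le_of_ne (hf0 x) hfx.symm)
    exact mul_pos hx0 (by nlinarith [hF0 x])
  have hnonnegν : 0 ≤ᵐ[ν] fun x => x * (1 - F x ^ 2) := by
    filter_upwards [ae_restrict_mem measurableSet_Ioi] with x hx0
    exact mul_nonneg (le_of_lt hx0) (by nlinarith [hF0 x, hF1 x])
  have hfi : Integrable f ν := by simpa using hPintegrable (fun _ => 1) (integrable_const 1)
  have hf1 : ∫ x, f x ∂ν = 1 := by simpa using (hPint fun _ => 1).symm
  have key := exp_integral_mul_log_sub_le hf0 hfi hf1 hintf hint1 hnonnegν hposν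
    (hPintegrable _ hlogP)
  rw [hElog, ge_iff_le, mul_assoc, ← Real.exp_add]
  refine mul_le_mul_of_nonneg_left (le_of_eq_of_le ?_ key) (by norm_num)
  congr 1
  ring
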